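/- Weighted space-time interpolation (Lemma 2.1, temporal version): let κ ∈ (0,1), T > 0, and let ρ₂, ρ₃ be polynomial weights on ℝ³. Then for every α ∈ [0, 2−κ] with α/2 ∉ ℕ₀ one has ‖ψ‖_{C_T^{α/2}L^∞(ρ₁)} ≲ ‖ψ‖_{L^∞_T L^∞(ρ₂)}^{1−α/(2−κ)} · ‖ψ‖_{C_T^{(2−κ)/2}L^∞(ρ₃)}^{α/(2−κ)}, where ρ₁ = ρ₂^{1−α/(2−κ)} ρ₃^{α/(2−κ)}. -/

import Mathlib

open MeasureTheory Set ENNReal NNReal Filter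

noncomputable section

/-- Three–dimensional Euclidean space `ℝ³`. -/
abbrev E3 : Type := EuclideanSpace ℝ (Fin 3)

/-- `pw σ x = ⟨x⟩^σ = (1+|x|²)^{σ/2}`.  The polynomial weight `ρ = ⟨x⟩^{-ν}` (`ν > 0`) of the
paper is `pw (-ν)`, and its power `ρ^a` is `pw (-(ν*a))`. -/
def pw (σ : ℝ) (x : E3) : ℝ := (1 + ‖x‖ ^ 2) ^ (σ / 2)

/-- A Littlewood–Paley family of blocks on `ℝ³`; the index `i : ℕ` corresponds to the
classical index `i - 1 ≥ -1` (so `Δ 0` is the classical block `Δ_{-1}`). -/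
structure LPBlocks where
  Δ : ℕ → (E3 → ℝ) → E3 → ℝ
  map_add : ∀ i f g, Δ i (fun x => f x + g x) = fun x => Δ i f x + Δ i g x
  map_smul : ∀ i (c : ℝ) f, Δ i (fun x => c * f x) = fun x => c * Δ i f x
  hasSum_blocks : ∀ f : E3 → ℝ, Continuous f → ∀ x, HasSum (fun i => Δ i f x) (f x)

/-- Weighted `L^∞` norm `‖w·f‖_{L^∞}`, valued in `ℝ≥0∞`. -/
def wnorm (w f : E3 → ℝ) : ℝ≥0∞ := ⨆ x : E3, (‖w x * f x‖₊ : ℝ≥0∞)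

/-- Weighted Besov–Hölder norm `‖f‖_{𝒞^α(w)} = sup_{i ≥ -1} 2^{iα} ‖w Δ_i f‖_{L^∞}`. -/
def besov (LP : LPBlocks) (α : ℝ) (w f : E3 → ℝ) : ℝ≥0∞ :=
  ⨆ i : ℕ, ENNReal.ofReal ((2 : ℝ) ^ (α * ((i : ℝ) - 1))) * wnorm w (LP.Δ i f)

/-- The `C_T 𝒞^α(w)` norm of a space-time function. -/
def ctBesov (LP : LPBlocks) (α : ℝ) (w : E3 → ℝ) (T : ℝ) (ψ : ℝ → E3 → ℝ) : ℝ≥0∞ :=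
  ⨆ t : Icc (0 : ℝ) T, besov LP α w (ψ t)

/-- The `L^∞_T L^∞(w)` norm of a space-time function. -/
def ltwnorm (w : E3 → ℝ) (T : ℝ) (ψ : ℝ → E3 → ℝ) : ℝ≥0∞ :=
  ⨆ t : Icc (0 : ℝ) T, wnorm w (ψ t)

/-- The `C_T^β L^∞(w)` (Hölder-in-time) norm of a space-time function. -/
def holderWnorm (β : ℝ) (w : E3 → ℝ) (T : ℝ) (ψ : ℝ → E3 → ℝ) : ℝ≥0∞ :=
  ltwnorm w T ψ +
    ⨆ s : Icc (0 : ℝ) T, ⨆ t : Icc (0 : ℝ) T,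
      wnorm w (fun x => ψ (t : ℝ) x - ψ (s : ℝ) x) /
        ENNReal.ofReal (|(t : ℝ) - (s : ℝ)| ^ β)

/-- The `C_T^β 𝒞^α(w)` (Hölder-in-time, Besov-in-space) norm. -/
def holderBesov (LP : LPBlocks) (β α : ℝ) (w : E3 → ℝ) (T : ℝ) (ψ : ℝ → E3 → ℝ) : ℝ≥0∞ :=
  ctBesov LP α w T ψ +
    ⨆ s : Icc (0 : ℝ) T, ⨆ t : Icc (0 : ℝ) T,
      besov LP α w (fun x => ψ (t : ℝ) x - ψ (s : ℝ) x) /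
        ENNReal.ofReal (|(t : ℝ) - (s : ℝ)| ^ β)

/-- The Laplacian on `ℝ³` (sum of the second partial derivatives). -/
def lap3 (f : E3 → ℝ) (x : E3) : ℝ :=
  ∑ i : Fin 3,
    fderiv ℝ (fun y => fderiv ℝ f y (EuclideanSpace.single i (1 : ℝ))) x
      (EuclideanSpace.single i (1 : ℝ))

/-- The parabolic operator `ℒ = ∂_t + (−Δ + μ)`. -/
def heatOp (μ : ℝ) (u : ℝ → E3 → ℝ) (t : ℝ) (x : E3) : ℝ :=
  deriv (fun s => u s x) t + (-(lap3 (u t) x) + μ * u t x)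

/-- Classical regularity of a space-time function on `[0,T]`:
differentiable in time, `C²` in space. -/
def IsClassical (T : ℝ) (u : ℝ → E3 → ℝ) : Prop :=
  (∀ x : E3, DifferentiableOn ℝ (fun s => u s x) (Icc 0 T)) ∧
    ∀ t ∈ Icc (0 : ℝ) T, ContDiff ℝ 2 (u t)

/-- The Bony paraproduct `f ≺ g = ∑_{i < j-1} Δ_i f · Δ_j g`. -/
def paraProd (LP : LPBlocks) (f g : E3 → ℝ) : E3 → ℝ := fun x =>
  ∑' j : ℕ, (∑ i ∈ Finset.range (j - 1), LP.Δ i f x) * LP.Δ j g x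

/-- The resonant product `f ∘ g = ∑_{|i-j| ≤ 1} Δ_i f · Δ_j g`. -/
def resonant (LP : LPBlocks) (f g : E3 → ℝ) : E3 → ℝ := fun x =>
  ∑' j : ℕ, ∑ i ∈ Finset.range (j + 2), if j ≤ i + 1 then LP.Δ i f x * LP.Δ j g x else 0


theorem wnorm_interpolate (ν₂ ν₃ θ : ℝ) (h0 : 0 ≤ θ) (h1 : θ ≤ 1) (f : E3 → ℝ) :
    wnorm (pw (-(ν₂ * (1 - θ) + ν₃ * θ))) f ≤
      wnorm (pw (-ν₂)) f ^ (1 - θ) * wnorm (pw (-ν₃)) f ^ θ := by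
  refine iSup_le fun x => ?_
  have hb : (0 : ℝ) < 1 + ‖x‖ ^ 2 := by positivity
  have h1' : 0 ≤ 1 - θ := sub_nonneg.2 h1
  have key : ‖pw (-(ν₂ * (1 - θ) + ν₃ * θ)) x * f x‖₊ =
      ‖pw (-ν₂) x * f x‖₊ ^ (1 - θ) * ‖pw (-ν₃) x * f x‖₊ ^ θ := by
    have hw : pw (-(ν₂ * (1 - θ) + ν₃ * θ)) x = pw (-ν₂) x ^ (1 - θ) * pw (-ν₃) x ^ θ := by
      simp only [pw]
      rw [← Real.rpow_mul hb.le, ← Real.rpow_mul hb.le, ← Real.rpow_add hb]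
      congr 1
      ring
    have hp : ∀ σ, 0 ≤ pw σ x := fun σ => Real.rpow_nonneg hb.le _
    have hf : ‖f x‖ = ‖f x‖ ^ (1 - θ) * ‖f x‖ ^ θ := by
      rw [← Real.rpow_add_of_nonneg (norm_nonneg _) h1' h0, sub_add_cancel, Real.rpow_one]
    apply NNReal.eq
    push_cast
    rw [norm_mul, norm_mul, norm_mul, Real.norm_of_nonneg (hp _), Real.norm_of_nonneg (hp _),
      Real.norm_of_nonneg (hp _), Real.mul_rpow (hp _) (norm_nonneg _),
      Real.mul_rpow (hp _) (norm_nonneg _), hw]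
    conv_lhs => rw [hf]
    ring
  rw [key, ENNReal.coe_mul, ENNReal.coe_rpow_of_nonneg _ h1', ENNReal.coe_rpow_of_nonneg _ h0]
  gcongr <;> exact le_iSup (fun y => (‖_ * f y‖₊ : ℝ≥0∞)) x

theorem wnorm_sub_le (w f g : E3 → ℝ) :
    wnorm w (fun x => f x - g x) ≤ wnorm w f + wnorm w g := by
  refine iSup_le fun x => ?_
  calc (‖w x * (f x - g x)‖₊ : ℝ≥0∞) ≤ ‖w x * f x‖₊ + ‖w x * g x‖₊ := by
        rw [mul_sub]
        exact_mod_cast nnnorm_sub_le _ _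
    _ ≤ _ := add_le_add (le_iSup (fun y => (‖w y * f y‖₊ : ℝ≥0∞)) x)
        (le_iSup (fun y => (‖w y * g y‖₊ : ℝ≥0∞)) x)

theorem wnorm_le_ltwnorm (w : E3 → ℝ) {T : ℝ} (ψ : ℝ → E3 → ℝ) (t : Icc (0 : ℝ) T) :
    wnorm w (ψ t) ≤ ltwnorm w T ψ :=
  le_iSup (fun s : Icc (0 : ℝ) T => wnorm w (ψ s)) t

theorem holderWnorm_interpolate (β ν₂ ν₃ θ T : ℝ) (h0 : 0 ≤ θ) (h1 : θ ≤ 1)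
    (ψ : ℝ → E3 → ℝ) :
    holderWnorm (β * θ) (pw (-(ν₂ * (1 - θ) + ν₃ * θ))) T ψ ≤
      3 * ltwnorm (pw (-ν₂)) T ψ ^ (1 - θ) * holderWnorm β (pw (-ν₃)) T ψ ^ θ := by
  have h1' : 0 ≤ 1 - θ := sub_nonneg.2 h1
  set A := ltwnorm (pw (-ν₂)) T ψ
  set B := holderWnorm β (pw (-ν₃)) T ψ
  have hsup : ltwnorm (pw (-(ν₂ * (1 - θ) + ν₃ * θ))) T ψ ≤ A ^ (1 - θ) * B ^ θ := by
    refine iSup_le fun t => (wnorm_interpolate ν₂ ν₃ θ h0 h1 _).trans ?_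
    gcongr
    · exact wnorm_le_ltwnorm _ ψ t
    · exact (wnorm_le_ltwnorm _ ψ t).trans le_self_add
  have hquot : ∀ s t : Icc (0 : ℝ) T,
      wnorm (pw (-(ν₂ * (1 - θ) + ν₃ * θ))) (fun x => ψ t x - ψ s x) /
        ENNReal.ofReal (|(t : ℝ) - s| ^ (β * θ)) ≤ 2 * A ^ (1 - θ) * B ^ θ := by
    intro s t
    have hA : wnorm (pw (-ν₂)) (fun x => ψ t x - ψ s x) ≤ 2 * A :=
      (wnorm_sub_le _ _ _).trans <| by
        rw [two_mul]
        exact add_le_add (wnorm_le_ltwnorm _ ψ t) (wnorm_le_ltwnorm _ ψ s)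
    have hBq : wnorm (pw (-ν₃)) (fun x => ψ t x - ψ s x) /
        ENNReal.ofReal (|(t : ℝ) - s| ^ β) ≤ B :=
      (le_iSup₂ (f := fun s t : Icc (0 : ℝ) T =>
        wnorm (pw (-ν₃)) (fun x => ψ t x - ψ s x) / ENNReal.ofReal (|(t : ℝ) - s| ^ β))
        s t).trans le_add_self
    rw [Real.rpow_mul (abs_nonneg _),
      ← ENNReal.ofReal_rpow_of_nonneg (Real.rpow_nonneg (abs_nonneg _) _) h0]
    calc _ ≤ wnorm (pw (-ν₂)) (fun x => ψ t x - ψ s x) ^ (1 - θ) *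
          wnorm (pw (-ν₃)) (fun x => ψ t x - ψ s x) ^ θ /
            ENNReal.ofReal (|(t : ℝ) - s| ^ β) ^ θ :=
          ENNReal.div_le_div_right (wnorm_interpolate ν₂ ν₃ θ h0 h1 _) _
      _ = wnorm (pw (-ν₂)) (fun x => ψ t x - ψ s x) ^ (1 - θ) *
          (wnorm (pw (-ν₃)) (fun x => ψ t x - ψ s x) /
            ENNReal.ofReal (|(t : ℝ) - s| ^ β)) ^ θ := by
          rw [mul_div_assoc, ENNReal.div_rpow_of_nonneg _ _ h0]
      _ ≤ (2 * A) ^ (1 - θ) * B ^ θ := by gcongr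
      _ = 2 ^ (1 - θ) * A ^ (1 - θ) * B ^ θ := by rw [ENNReal.mul_rpow_of_nonneg _ _ h1']
      _ ≤ 2 * A ^ (1 - θ) * B ^ θ := by
          gcongr
          simpa using ENNReal.rpow_le_rpow_of_exponent_le (one_le_two (α := ℝ≥0∞))
            (sub_le_self 1 h0)
  calc _ ≤ A ^ (1 - θ) * B ^ θ + 2 * A ^ (1 - θ) * B ^ θ :=
        add_le_add hsup (iSup₂_le hquot)
    _ = 3 * A ^ (1 - θ) * B ^ θ := by ring

/-- Lemma 2.1, temporal version: weighted space-time interpolation for the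
Hölder-in-time norms.  For `κ ∈ (0,1)`, `T > 0`, polynomial weights `ρ₂ = ⟨x⟩^{-ν₂}`,
`ρ₃ = ⟨x⟩^{-ν₃}` and every `α ∈ [0, 2-κ]` with `α/2 ∉ ℕ₀`,
`‖ψ‖_{C_T^{α/2}L^∞(ρ₁)} ≲ ‖ψ‖_{L^∞_T L^∞(ρ₂)}^{1-α/(2-κ)} ‖ψ‖_{C_T^{(2-κ)/2}L^∞(ρ₃)}^{α/(2-κ)}`
with `ρ₁ = ρ₂^{1-α/(2-κ)} ρ₃^{α/(2-κ)}`. -/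
theorem weighted_interpolation_temporal
    (κ T ν₂ ν₃ : ℝ) (hκ : κ ∈ Set.Ioo (0 : ℝ) 1) (hT : 0 < T)
    (hν₂ : 0 < ν₂) (hν₃ : 0 < ν₃) :
    ∀ α ∈ Set.Icc (0 : ℝ) (2 - κ), (∀ n : ℕ, α / 2 ≠ (n : ℝ)) →
      ∃ C : ℝ≥0, 0 < C ∧ ∀ ψ : ℝ → E3 → ℝ,
        holderWnorm (α / 2) (pw (-(ν₂ * (1 - α / (2 - κ)) + ν₃ * (α / (2 - κ))))) T ψ ≤
          C * ltwnorm (pw (-ν₂)) T ψ ^ (1 - α / (2 - κ)) *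
            holderWnorm ((2 - κ) / 2) (pw (-ν₃)) T ψ ^ (α / (2 - κ)) := by
  intro α hα _
  have hpos : 0 < 2 - κ := by linarith [hκ.2]
  refine ⟨3, by norm_num, fun ψ => ?_⟩
  have h := holderWnorm_interpolate ((2 - κ) / 2) ν₂ ν₃ (α / (2 - κ)) T
    (div_nonneg hα.1 hpos.le) ((div_le_one hpos).2 hα.2) ψ
  rw [show (2 - κ) / 2 * (α / (2 - κ)) = α / 2 by field_simp] at h
  exact_mod_cast h
end
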